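/- arXiv:2405.17087 — 2 statements merged into one kernel-verified Lean document; each statement's English description precedes it below -/
import Mathlib

section
/- Let ν > 0, q > 1, S > 0. Then there exists K ∈ ℕ such that for every k ≥ K and every real sequence a = (a_k)_{k≥1} with |a_n| ≤ S q^{−n} for all n ≥ 1 and with |a_k| = S q^{−k}, one has a_k F_k(a) < 0. (Isolation property of the KS vector field on the set W_{q,S}.) -/
/-- The Kuramoto–Sivashinsky vector field in Fourier coordinates:
`F_k(a) = k²(1 - ν k²) a_k - k Σ_{n=1}^{k-1} a_n a_{k-n} + 2k Σ_{n=1}^∞ a_n a_{n+k}`. -/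
noncomputable def ksF (ν : ℝ) (a : ℕ → ℝ) (k : ℕ) : ℝ :=
  (k : ℝ) ^ 2 * (1 - ν * (k : ℝ) ^ 2) * a k
    - (k : ℝ) * ∑ n ∈ Finset.Ico 1 k, a n * a (k - n)
    + 2 * (k : ℝ) * ∑' n : ℕ, a (n + 1) * a (n + 1 + k)

/-- Let `ν > 0`, `q > 1`, `S > 0`.  Then there exists `K ∈ ℕ` such that for every
`k ≥ K` and every real sequence `a` with `|a_n| ≤ S q^{-n}` for all `n ≥ 1` and with
`|a_k| = S q^{-k}`, one has `a_k F_k(a) < 0` (isolation property of the KS vector field on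
`W_{q,S}`). -/
theorem stmt4 (ν q S : ℝ) (hν : 0 < ν) (hq : 1 < q) (hS : 0 < S) :
    ∃ K : ℕ, ∀ k : ℕ, K ≤ k → ∀ a : ℕ → ℝ,
      (∀ n : ℕ, 1 ≤ n → |a n| ≤ S / q ^ n) → |a k| = S / q ^ k →
        a k * ksF ν a k < 0 := by
  have hq0 : 0 < q := by linarith
  obtain ⟨r, hr⟩ : ∃ r, r = q⁻¹ := ⟨_, rfl⟩
  have hr0 : 0 < r := by rw [hr]; positivity
  have hr1 : r < 1 := by rw [hr]; exact inv_lt_one_of_one_lt₀ hq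
  obtain ⟨C, hC⟩ : ∃ C, C = S * (1 - r)⁻¹ := ⟨_, rfl⟩
  have hC0 : 0 < C := by
    have : 0 < 1 - r := by linarith
    rw [hC]; positivity
  obtain ⟨K, hK⟩ := exists_nat_gt ((1 + S + 2 * C) / ν)
  refine ⟨K + 1, fun k hk a ha hak => ?_⟩
  have hk1 : (1 : ℝ) ≤ k := by exact_mod_cast (by omega : 1 ≤ k)
  have hkK : (K : ℝ) ≤ k := by exact_mod_cast (by omega : K ≤ k)
  have hform : ∀ n : ℕ, S / q ^ n = S * r ^ n := by
    intro n; rw [hr, inv_pow, div_eq_mul_inv]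
  simp only [hform] at ha hak
  obtain ⟨A, hA⟩ : ∃ A, A = S * r ^ k := ⟨_, rfl⟩
  have hA0 : 0 < A := by rw [hA]; positivity
  rw [← hA] at hak
  have hfin : |∑ n ∈ Finset.Ico 1 k, a n * a (k - n)| ≤ k * (S * A) := by
    have h1 : ∀ n ∈ Finset.Ico 1 k, |a n * a (k - n)| ≤ S * A := by
      intro n hn
      rw [Finset.mem_Ico] at hn
      rw [abs_mul]
      calc |a n| * |a (k - n)| ≤ (S * r ^ n) * (S * r ^ (k - n)) :=
            mul_le_mul (ha n hn.1) (ha _ (by omega)) (abs_nonneg _) (by positivity)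
        _ = S * (S * (r ^ n * r ^ (k - n))) := by ring
        _ = S * A := by rw [← pow_add, hA, Nat.add_sub_cancel' hn.2.le]
    calc _ ≤ ∑ n ∈ Finset.Ico 1 k, |a n * a (k - n)| := Finset.abs_sum_le_sum_abs _ _
      _ ≤ ∑ n ∈ Finset.Ico 1 k, S * A := Finset.sum_le_sum h1
      _ = ((k - 1 : ℕ) : ℝ) * (S * A) := by simp
      _ ≤ k * (S * A) := by
        apply mul_le_mul_of_nonneg_right _ (by positivity)
        exact_mod_cast Nat.sub_le k 1
  have hinf : |∑' n : ℕ, a (n + 1) * a (n + 1 + k)| ≤ A * C := by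
    have hs : HasSum (fun n : ℕ => (A * S) * r ^ n) (A * C) := by
      have := (hasSum_geometric_of_lt_one hr0.le hr1).mul_left (A * S)
      rwa [mul_assoc, ← hC] at this
    rw [← Real.norm_eq_abs]
    refine tsum_of_norm_bounded hs fun n => ?_
    rw [Real.norm_eq_abs, abs_mul]
    calc |a (n + 1)| * |a (n + 1 + k)| ≤ (S * r ^ (n + 1)) * (S * r ^ (n + 1 + k)) :=
          mul_le_mul (ha _ (by omega)) (ha _ (by omega)) (abs_nonneg _) (by positivity)
      _ = (A * S) * r ^ n * (r * r ^ (n + 1)) := by rw [hA]; ring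
      _ ≤ (A * S) * r ^ n * 1 := by
          apply mul_le_mul_of_nonneg_left _ (by positivity)
          exact mul_le_one₀ hr1.le (by positivity) (pow_le_one₀ hr0.le hr1.le)
      _ = (A * S) * r ^ n := mul_one _
  unfold ksF
  generalize (∑ n ∈ Finset.Ico 1 k, a n * a (k - n)) = P at *
  generalize (∑' n : ℕ, a (n + 1) * a (n + 1 + k)) = Q at *
  generalize a k = x at *
  generalize (k : ℝ) = t at *
  have hx2 : x * x = A * A := by rw [← hak, abs_mul_abs_self]
  have hP : -(x * P) ≤ A * (t * (S * A)) := by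
    refine (neg_le_abs _).trans ?_
    rw [abs_mul, hak]
    exact mul_le_mul_of_nonneg_left hfin hA0.le
  have hQ : x * Q ≤ A * (A * C) := by
    refine (le_abs_self _).trans ?_
    rw [abs_mul, hak]
    exact mul_le_mul_of_nonneg_left hinf hA0.le
  have ht : 1 + S + 2 * C < ν * t ^ 2 := by
    have h1 : 1 + S + 2 * C < t * ν := (div_lt_iff₀ hν).1 (hK.trans_le hkK)
    nlinarith [mul_nonneg hν.le (mul_nonneg (by linarith : 0 ≤ t) (sub_nonneg.2 hk1))]
  have ht0 : 0 < t := by linarith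
  have hP' := mul_le_mul_of_nonneg_left hP ht0.le
  have hQ' := mul_le_mul_of_nonneg_left hQ (by linarith : 0 ≤ 2 * t)
  have e : x * (t ^ 2 * (1 - ν * t ^ 2) * x - t * P + 2 * t * Q)
      = t ^ 2 * (1 - ν * t ^ 2) * (A * A) + t * -(x * P) + 2 * t * (x * Q) := by
    rw [← hx2]; ring
  rw [e]
  have hneg : 0 < t ^ 2 * (A * A) * (ν * t ^ 2 - (1 + S + 2 * C)) :=
    mul_pos (by positivity) (sub_pos.2 ht)
  have hc : 0 ≤ (A * A * C) * (t * (t - 1)) :=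
    mul_nonneg (by positivity) (mul_nonneg ht0.le (sub_nonneg.2 hk1))
  nlinarith [hneg, hc, hP', hQ']
end

section
/- Let A be an n×n real matrix and let ‖·‖ denote the operator norm on n×n matrices induced by the maximum norm ‖x‖_∞ = max_i |x_i| on ℝⁿ. Then the limit μ(A) = lim_{h → 0⁺} (‖Id + hA‖ − 1)/h exists and equals max_{i=1,…,n} ( A_{ii} + Σ_{k ≠ i} |A_{ik}| ). -/
section helpers
attribute [local instance] Matrix.linftyOpNormedAddCommGroup

theorem aux_norm (n : ℕ) (B : Matrix (Fin n) (Fin n) ℝ) :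
    ‖LinearMap.toContinuousLinearMap (Matrix.mulVecLin B)‖ =
      (((Finset.univ : Finset (Fin n)).sup fun i => ∑ j, ‖B i j‖₊ : NNReal) : ℝ) := by
  rw [← Matrix.linfty_opNorm_def B, Matrix.linfty_opNorm_eq_opNorm]
  rfl

end helpers

theorem aux_row (n : ℕ) (A : Matrix (Fin n) (Fin n) ℝ) (h : ℝ) (hh : 0 < h) (i : Fin n)
    (hi : 0 ≤ 1 + h * A i i) :
    ((∑ j, ‖(1 + h • A) i j‖₊ : NNReal) : ℝ) =
      1 + h * (A i i + ∑ k ∈ Finset.univ.erase i, |A i k|) := by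
  push_cast
  rw [← Finset.add_sum_erase _ _ (Finset.mem_univ i), mul_add, Finset.mul_sum, ← add_assoc]
  congr 1
  · simp [abs_of_nonneg hi]
  · refine Finset.sum_congr rfl fun k hk => ?_
    have hk' : i ≠ k := (Finset.ne_of_mem_erase hk).symm
    simp [Matrix.one_apply_ne hk', abs_mul, abs_of_pos hh]

/-- Let `A` be an `n × n` real matrix and `‖·‖` the operator norm on matrices
induced by the maximum norm `‖x‖_∞ = max_i |x_i|` on `ℝⁿ` (here realized as the operator norm
of the induced continuous linear map on `Fin n → ℝ`, whose norm is the sup norm).  Then the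
limit `μ(A) = lim_{h → 0⁺} (‖Id + hA‖ - 1)/h` exists and equals
`max_{i} (A_{ii} + Σ_{k ≠ i} |A_{ik}|)`. -/
theorem stmt13 (n : ℕ) (hn : 0 < n) (A : Matrix (Fin n) (Fin n) ℝ) :
    Filter.Tendsto
      (fun h : ℝ =>
        (‖LinearMap.toContinuousLinearMap (Matrix.mulVecLin (1 + h • A))‖ - 1) / h)
      (nhdsWithin 0 (Set.Ioi 0))
      (nhds (⨆ i : Fin n, (A i i + ∑ k ∈ Finset.univ.erase i, |A i k|))) := by
  have : Nonempty (Fin n) := ⟨⟨0, hn⟩⟩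
  have hev : ∀ᶠ h : ℝ in nhdsWithin 0 (Set.Ioi 0), ∀ i : Fin n, 0 ≤ 1 + h * A i i := by
    rw [Filter.eventually_all]
    intro i
    apply Filter.Eventually.filter_mono nhdsWithin_le_nhds
    have hc : Filter.Tendsto (fun h : ℝ => 1 + h * A i i) (nhds 0) (nhds (1 + 0 * A i i)) :=
      Continuous.tendsto (by fun_prop) 0
    exact hc.eventually (Filter.Eventually.mono (lt_mem_nhds (by norm_num : (0:ℝ) < 1 + 0 * A i i))
      fun _ hx => le_of_lt hx)
  refine Filter.Tendsto.congr' ?_ tendsto_const_nhds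
  filter_upwards [hev, self_mem_nhdsWithin] with h hi hh
  have hh : 0 < h := hh
  rw [eq_div_iff hh.ne', eq_sub_iff_add_eq, aux_norm]
  apply le_antisymm
  · obtain ⟨j, hj⟩ := exists_eq_ciSup_of_finite
      (f := fun i : Fin n => (A i i + ∑ k ∈ Finset.univ.erase i, |A i k|))
    rw [← hj, mul_comm, add_comm, ← aux_row n A h hh j (hi j), NNReal.coe_le_coe]
    exact Finset.le_sup (f := fun i => ∑ j, ‖(1 + h • A) i j‖₊) (Finset.mem_univ j)
  · obtain ⟨i, -, he⟩ := Finset.exists_mem_eq_sup Finset.univ Finset.univ_nonempty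
      (fun i => ∑ j, ‖(1 + h • A) i j‖₊)
    rw [he, aux_row n A h hh i (hi i), mul_comm, add_comm]
    gcongr
    exact le_ciSup (f := fun i : Fin n => (A i i + ∑ k ∈ Finset.univ.erase i, |A i k|))
      (Set.finite_range _).bddAbove i
end
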